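/- Let α ∈ (0,1), θ > 0, λ₁,…,λ_k > 0, λ = ∑_{j=1}^{k} λ_j, t ≥ 0, and u ∈ ℝ with 0 ≤ u ≤ 1. Then exp(-t·((∑_{j=1}^{k} λ_j(1-u^j) + θ)^α - θ^α)) = ∑_{n=0}^{∞} u^n · ( e^{tθ^α}·∑_{x ∈ Ω(k,n)} ∑_{r=0}^{∞} ((-t(λ+θ)^α)^r/r!)·(Γ(αr+1)/Γ(αr + 1 - ∑_{j=1}^{k} x_j))·∏_{j=1}^{k} ((-λ_j/(λ+θ))^{x_j}/x_j!) ), where Ω(k,n) = {x ∈ ℕ^k : ∑_j j x_j = n}, all series converging absolutely. -/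

import Mathlib

open scoped BigOperators

/-- Pmf of the GCP time-changed by a tempered `α`-stable subordinator.
Note `Real.Gamma` vanishes at nonpositive integers, so `1/Γ` is `0` there. -/
noncomputable def tgcpPMF (α θ : ℝ) (k : ℕ) (lam : Fin k → ℝ) (t : ℝ) (n : ℕ) : ℝ :=
  Real.exp (t * θ ^ α) *
    ∑' x : Fin k → ℕ,
      if (∑ j, (j.1 + 1) * x j) = n then
        ∑' r : ℕ, (-(t * ((∑ j, lam j) + θ) ^ α)) ^ r / (Nat.factorial r : ℝ) *
          (Real.Gamma (α * r + 1) / Real.Gamma (α * r + 1 - (∑ j, (x j : ℝ)))) *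
          ∏ j, (-(lam j) / ((∑ i, lam i) + θ)) ^ (x j) / (Nat.factorial (x j) : ℝ)
      else 0

noncomputable def dpoch (a : ℝ) (m : ℕ) : ℝ := ∏ i ∈ Finset.range m, (a - i)

lemma dpoch_succ (a : ℝ) (m : ℕ) : dpoch a (m+1) = dpoch a m * (a - m) := by
  simp [dpoch, Finset.prod_range_succ]

lemma gamma_ratio (a : ℝ) (ha : 0 ≤ a) (m : ℕ) :
    Real.Gamma (a + 1) / Real.Gamma (a + 1 - m) = dpoch a m := by
  induction m with
  | zero =>
    have : Real.Gamma (a+1) ≠ 0 := (Real.Gamma_pos_of_pos (by linarith)).ne'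
    simp [dpoch, this]
  | succ m ih =>
    rw [dpoch_succ, ← ih]
    have e : a + 1 - ((m + 1 : ℕ) : ℝ) = a - m := by push_cast; ring
    have e2 : a + 1 - (m : ℝ) = (a - m) + 1 := by ring
    rw [e, e2]
    by_cases h : a - (m : ℝ) = 0
    · rw [h]; simp
    · rw [Real.Gamma_add_one h]
      by_cases h2 : Real.Gamma (a - m) = 0
      · simp [h2]
      · field_simp

lemma dpoch_choose (a : ℝ) (m : ℕ) : Ring.choose a m = dpoch a m / m.factorial := by
  have h : (descPochhammer ℤ m).smeval a = dpoch a m := by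
    induction m with
    | zero => simp [dpoch]
    | succ m ih =>
      rw [dpoch_succ, ← ih, descPochhammer_succ_right, Polynomial.smeval_mul,
        Polynomial.smeval_sub, Polynomial.smeval_X, Polynomial.smeval_natCast]
      simp
  rw [Ring.choose_eq_smul, h, smul_eq_mul]
  field_simp

lemma binom_hasSum (a v : ℝ) (hv0 : 0 ≤ v) (hv : v < 1) :
    HasSum (fun m : ℕ => ((-1) ^ m * dpoch a m) * v ^ m / m.factorial) ((1 - v) ^ a) := by
  have h := (Real.one_add_rpow_hasFPowerSeriesOnBall_zero (a := a)).hasSum (y := -v) (by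
    simp [Metric.mem_eball, edist_dist, abs_of_nonneg hv0, hv])
  simp only [binomialSeries_apply, List.ofFn_const, List.prod_replicate, zero_add, smul_eq_mul,
    dpoch_choose] at h
  rw [← sub_eq_add_neg] at h
  convert! h using 2 with m
  rw [neg_pow v]; ring

lemma dpoch_abs_le (a : ℝ) (ha : 0 ≤ a) (m : ℕ) :
    |(-1) ^ m * dpoch a m| ≤ (-1) ^ m * dpoch (-a) m := by
  induction m with
  | zero => simp [dpoch]
  | succ m ih =>
    rw [dpoch_succ, dpoch_succ, abs_mul, abs_mul]
    have e : (-1 : ℝ) ^ (m+1) * (dpoch (-a) m * (-a - m)) = ((-1) ^ m * dpoch (-a) m) * (a + m) := by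
      ring
    rw [e]
    simp only [abs_pow, abs_neg, abs_one, one_pow, one_mul, abs_mul] at ih ⊢
    have : |a - (m : ℝ)| ≤ a + m := by
      have hm : (0 : ℝ) ≤ m := Nat.cast_nonneg m
      rw [abs_le]; constructor <;> linarith
    exact mul_le_mul ih this (abs_nonneg _) ((abs_nonneg _).trans ih)

lemma fiber_hasSum {X : Type*} (N : X → ℕ) (h : X → ℝ) (s : ℝ) :
    HasSum (fun p : ℕ × X => if N p.2 = p.1 then h p.2 else 0) s ↔ HasSum h s := by
  have hinj : Function.Injective (fun x : X => (N x, x)) := fun a b hab => (Prod.ext_iff.1 hab).2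
  rw [← hinj.hasSum_iff]
  · apply iff_of_eq; congr 1; funext x; simp
  · rintro ⟨n, x⟩ hx
    have : N x ≠ n := by
      rintro rfl; exact hx ⟨x, rfl⟩
    simp [this]

lemma multi_fiber {k : ℕ} (c : ℕ → ℝ) (y : Fin k → ℝ) (m : ℕ) :
    HasSum (fun x : Fin k → ℕ => if (∑ j, x j) = m then
      c (∑ j, x j) * ∏ j, (y j) ^ (x j) / ((x j).factorial : ℝ) else 0)
      (c m * (∑ j, y j) ^ m / m.factorial) := by
  have h : c m * (∑ j, y j) ^ m / m.factorial = ∑ x ∈ Finset.piAntidiag Finset.univ m,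
      if (∑ j, x j) = m then
      c (∑ j, x j) * ∏ j, (y j) ^ (x j) / ((x j).factorial : ℝ) else 0 := by
    rw [Finset.sum_pow_eq_sum_piAntidiag, Finset.mul_sum, Finset.sum_div]
    refine Finset.sum_congr rfl fun x hx => ?_
    have hx' : ∑ j, x j = m := (Finset.mem_piAntidiag.1 hx).1
    rw [if_pos hx', hx', Finset.prod_div_distrib]
    have hs := Nat.multinomial_spec Finset.univ x
    rw [hx'] at hs
    have hs' : ((∏ j, (x j).factorial : ℕ) : ℝ) * (Nat.multinomial Finset.univ x : ℝ)
      = m.factorial := by exact_mod_cast hs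
    push_cast at hs'
    have h1 : (∏ j, ((x j).factorial : ℝ)) ≠ 0 :=
      Finset.prod_ne_zero_iff.2 fun j _ => by positivity
    have h2 : (m.factorial : ℝ) ≠ 0 := by positivity
    rw [div_eq_iff h2, ← hs']
    field_simp
  rw [h]
  apply hasSum_sum_of_ne_finset_zero
  intro x hx
  rw [if_neg]
  intro h; apply hx; simp [h]

lemma multi_nonneg {k : ℕ} (c : ℕ → ℝ) (hc : ∀ m, 0 ≤ c m) (y : Fin k → ℝ) (hy : ∀ j, 0 ≤ y j)
    (hs : Summable fun m : ℕ => c m * (∑ j, y j) ^ m / m.factorial) :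
    Summable (fun x : Fin k → ℕ =>
      c (∑ j, x j) * ∏ j, (y j) ^ (x j) / ((x j).factorial : ℝ)) := by
  suffices h : Summable (fun p : ℕ × (Fin k → ℕ) => if (∑ j, p.2 j) = p.1 then
      c (∑ j, p.2 j) * ∏ j, (y j) ^ (p.2 j) / ((p.2 j).factorial : ℝ) else 0) by
    obtain ⟨s, h⟩ := h
    exact ⟨s, (fiber_hasSum (fun x : Fin k → ℕ => ∑ j, x j) _ s).1 h⟩
  rw [summable_prod_of_nonneg]
  · refine ⟨fun m => (multi_fiber c y m).summable, ?_⟩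
    simpa only [(multi_fiber c y _).tsum_eq] using hs
  · intro p
    simp only [Pi.zero_apply]
    split_ifs
    · exact mul_nonneg (hc _) (Finset.prod_nonneg fun j _ =>
        div_nonneg (pow_nonneg (hy j) _) (by positivity))
    · exact le_rfl

lemma multi_hasSum {k : ℕ} (c : ℕ → ℝ) (y : Fin k → ℝ) (hy : ∀ j, 0 ≤ y j) (s : ℝ)
    (hs : Summable fun m : ℕ => |c m| * (∑ j, y j) ^ m / m.factorial)
    (hs' : HasSum (fun m : ℕ => c m * (∑ j, y j) ^ m / m.factorial) s) :
    HasSum (fun x : Fin k → ℕ =>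
      c (∑ j, x j) * ∏ j, (y j) ^ (x j) / ((x j).factorial : ℝ)) s := by
  have h1 := multi_nonneg (fun m => |c m|) (fun m => abs_nonneg _) y hy hs
  have h2 : Summable (fun x : Fin k → ℕ =>
      c (∑ j, x j) * ∏ j, (y j) ^ (x j) / ((x j).factorial : ℝ)) := by
    apply Summable.of_abs
    refine h1.congr fun x => ?_
    rw [abs_mul, abs_of_nonneg (a := ∏ j, _)]
    exact Finset.prod_nonneg fun j _ => div_nonneg (pow_nonneg (hy j) _) (by positivity)
  obtain ⟨s', h2⟩ := h2
  have h3 := ((fiber_hasSum (fun x : Fin k → ℕ => ∑ j, x j) _ s').2 h2).prod_fiberwise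
    (fun m => multi_fiber c y m)
  rwa [hs'.unique h3]

lemma double_hasSum {k : ℕ} (α T : ℝ) (hα : 0 < α) (y : Fin k → ℝ) (hy : ∀ j, 0 ≤ y j)
    (hv : ∑ j, y j < 1) :
    HasSum (fun p : (Fin k → ℕ) × ℕ => T ^ p.2 / p.2.factorial *
      (((-1) ^ (∑ j, p.1 j) * dpoch (α * p.2) (∑ j, p.1 j)) *
        ∏ j, (y j) ^ (p.1 j) / ((p.1 j).factorial : ℝ)))
      (Real.exp (T * (1 - ∑ j, y j) ^ α)) := by
  set v := ∑ j, y j with hvdef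
  have hv0 : 0 ≤ v := Finset.sum_nonneg fun j _ => hy j
  have hP : ∀ x : Fin k → ℕ, 0 ≤ ∏ j, (y j) ^ (x j) / ((x j).factorial : ℝ) := fun x =>
    Finset.prod_nonneg fun j _ => div_nonneg (pow_nonneg (hy j) _) (by positivity)
  have hb : ∀ r : ℕ, HasSum (fun m : ℕ => ((-1) ^ m * dpoch (-(α * r)) m) * v ^ m / m.factorial)
      ((1 - v) ^ (-(α * r))) := fun r => binom_hasSum _ v hv0 hv
  have har : ∀ r : ℕ, 0 ≤ α * r := fun r => by positivity
  have hnn : ∀ (r m : ℕ), 0 ≤ (-1) ^ m * dpoch (-(α * r)) m := fun r m =>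
    (abs_nonneg _).trans (dpoch_abs_le _ (har r) m)
  have hbig : ∀ r : ℕ, HasSum (fun x : Fin k → ℕ =>
      ((-1) ^ (∑ j, x j) * dpoch (-(α * r)) (∑ j, x j)) *
        ∏ j, (y j) ^ (x j) / ((x j).factorial : ℝ)) ((1 - v) ^ (-(α * r))) := fun r => by
    apply multi_hasSum (fun m => (-1) ^ m * dpoch (-(α * r)) m) y hy _ _ (hb r)
    simp only [abs_of_nonneg (hnn r _)]
    exact (hb r).summable
  have hsm : ∀ r : ℕ, HasSum (fun x : Fin k → ℕ =>
      ((-1) ^ (∑ j, x j) * dpoch (α * r) (∑ j, x j)) *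
        ∏ j, (y j) ^ (x j) / ((x j).factorial : ℝ)) ((1 - v) ^ (α * r)) := fun r => by
    apply multi_hasSum (fun m => (-1) ^ m * dpoch (α * r) m) y hy _ _ (binom_hasSum _ v hv0 hv)
    refine Summable.of_nonneg_of_le (fun m => ?_) (fun m => ?_) (hb r).summable
    · exact div_nonneg (mul_nonneg (abs_nonneg _) (pow_nonneg hv0 _)) (by positivity)
    · have := dpoch_abs_le _ (har r) m
      gcongr
  have h1v : 0 < 1 - v := by linarith
  have hS : Summable (fun p : ℕ × (Fin k → ℕ) => T ^ p.1 / p.1.factorial *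
      (((-1) ^ (∑ j, p.2 j) * dpoch (α * p.1) (∑ j, p.2 j)) *
        ∏ j, (y j) ^ (p.2 j) / ((p.2 j).factorial : ℝ))) := by
    have hB : Summable (fun p : ℕ × (Fin k → ℕ) => |T| ^ p.1 / p.1.factorial *
      (((-1) ^ (∑ j, p.2 j) * dpoch (-(α * p.1)) (∑ j, p.2 j)) *
        ∏ j, (y j) ^ (p.2 j) / ((p.2 j).factorial : ℝ))) := by
      rw [summable_prod_of_nonneg]
      · refine ⟨fun r => (hbig r).summable.mul_left (|T| ^ r / (r.factorial : ℝ)), ?_⟩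
        refine (Real.summable_pow_div_factorial (|T| * (1 - v) ^ (-α))).congr fun r => ?_
        refine Eq.trans ?_ ((hbig r).mul_left (|T| ^ r / r.factorial)).tsum_eq.symm
        rw [mul_pow, ← Real.rpow_mul_natCast h1v.le, neg_mul]; ring
      · intro p
        exact mul_nonneg (by positivity) (mul_nonneg (hnn _ _) (hP _))
    refine Summable.of_norm_bounded hB fun p => ?_
    rw [Real.norm_eq_abs, abs_mul, abs_mul _ (∏ j, _), abs_of_nonneg (hP _), abs_div, abs_pow,
      Nat.abs_cast]
    exact mul_le_mul_of_nonneg_left (mul_le_mul_of_nonneg_right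
      (dpoch_abs_le _ (har _) _) (hP _)) (by positivity)
  have hT := hS.hasSum.prod_fiberwise (fun r => (hsm r).mul_left (T ^ r / (r.factorial : ℝ)))
  have hE : HasSum (fun r : ℕ => T ^ r / r.factorial * (1 - v) ^ (α * r))
      (Real.exp (T * (1 - v) ^ α)) := by
    have := NormedSpace.expSeries_div_hasSum_exp (T * (1 - v) ^ α)
    rw [← Real.exp_eq_exp_ℝ] at this
    convert! this using 2 with r
    rw [mul_pow, ← Real.rpow_mul_natCast h1v.le]; ring
  have hS' := hS.hasSum
  rw [hT.unique hE] at hS'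
  exact (Equiv.prodComm _ _).hasSum_iff.1 hS'

/-- Pgf of the GCP time-changed by a tempered `α`-stable subordinator:
`exp(-t((∑_j λ_j(1-u^j)+θ)^α - θ^α)) = ∑_n u^n p_Z(n,t)`. -/
theorem tempered_gcp_pgf (α : ℝ) (hα0 : 0 < α) (hα1 : α < 1) (θ : ℝ) (hθ : 0 < θ)
    (k : ℕ) (lam : Fin k → ℝ) (hlam : ∀ j, 0 < lam j)
    (t : ℝ) (ht : 0 ≤ t) (u : ℝ) (hu0 : 0 ≤ u) (hu1 : u ≤ 1) :
    (∀ x : Fin k → ℕ,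
      Summable (fun r : ℕ => (-(t * ((∑ j, lam j) + θ) ^ α)) ^ r / (Nat.factorial r : ℝ) *
        (Real.Gamma (α * r + 1) / Real.Gamma (α * r + 1 - (∑ j, (x j : ℝ)))) *
        ∏ j, (-(lam j) / ((∑ i, lam i) + θ)) ^ (x j) / (Nat.factorial (x j) : ℝ))) ∧
    Summable (fun n : ℕ => u ^ n * tgcpPMF α θ k lam t n) ∧
    Real.exp (-(t * (((∑ j, lam j * (1 - u ^ (j.1 + 1))) + θ) ^ α - θ ^ α))) =
      ∑' n : ℕ, u ^ n * tgcpPMF α θ k lam t n := by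
  set L := (∑ i, lam i) + θ with hL
  have hsum0 : 0 ≤ ∑ i, lam i := Finset.sum_nonneg fun j _ => (hlam j).le
  have hLpos : 0 < L := by linarith
  set T := -(t * L ^ α) with hT
  have key : ∀ w : ℝ, 0 ≤ w → w ≤ 1 →
      HasSum (fun p : (Fin k → ℕ) × ℕ => w ^ (∑ j, (j.1 + 1) * p.1 j) *
        (T ^ p.2 / (Nat.factorial p.2 : ℝ) *
        (Real.Gamma (α * p.2 + 1) / Real.Gamma (α * p.2 + 1 - (∑ j, (p.1 j : ℝ)))) *
        ∏ j, (-(lam j) / L) ^ (p.1 j) / (Nat.factorial (p.1 j) : ℝ)))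
      (Real.exp (T * (1 - ∑ j, lam j / L * w ^ (j.1 + 1)) ^ α)) := by
    intro w hw0 hw1
    have hv : ∑ j, lam j / L * w ^ (j.1 + 1) < 1 := by
      calc ∑ j, lam j / L * w ^ (j.1 + 1) ≤ ∑ j, lam j / L := by
            refine Finset.sum_le_sum fun j _ => ?_
            exact mul_le_of_le_one_right (div_nonneg (hlam j).le hLpos.le) (pow_le_one₀ hw0 hw1)
        _ < 1 := by
            rw [← Finset.sum_div, div_lt_one hLpos]; linarith
    have h := double_hasSum α T hα0 (fun j => lam j / L * w ^ (j.1 + 1))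
      (fun j => mul_nonneg (div_nonneg (hlam j).le hLpos.le) (pow_nonneg hw0 _)) hv
    convert! h using 2 with p
    obtain ⟨x, r⟩ := p
    dsimp only
    have hg := gamma_ratio (α * r) (by positivity) (∑ j, x j)
    push_cast at hg
    rw [hg, ← Finset.prod_pow_eq_pow_sum, ← Finset.prod_pow_eq_pow_sum]
    have hp : (∏ j : Fin k, w ^ ((j.1 + 1) * x j)) *
        ∏ j, (-(lam j) / L) ^ (x j) / (Nat.factorial (x j) : ℝ) =
        (∏ j, (-1 : ℝ) ^ (x j)) *
          ∏ j : Fin k, (lam j / L * w ^ (j.1 + 1)) ^ (x j) / ((x j).factorial : ℝ) := by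
      rw [← Finset.prod_mul_distrib, ← Finset.prod_mul_distrib]
      refine Finset.prod_congr rfl fun j _ => ?_
      rw [pow_mul, mul_pow, neg_div, neg_pow (lam j / L)]; ring
    linear_combination (T ^ r / (Nat.factorial r : ℝ) * dpoch (α * r) (∑ j, x j)) * hp
  have h1 := key 1 zero_le_one le_rfl
  simp only [one_pow, one_mul] at h1
  have hsec : ∀ x : Fin k → ℕ,
      Summable (fun r : ℕ => T ^ r / (Nat.factorial r : ℝ) *
        (Real.Gamma (α * r + 1) / Real.Gamma (α * r + 1 - (∑ j, (x j : ℝ)))) *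
        ∏ j, (-(lam j) / L) ^ (x j) / (Nat.factorial (x j) : ℝ)) := fun x =>
    h1.summable.prod_factor x
  refine ⟨hsec, ?_⟩
  have hu := key u hu0 hu1
  have hx := hu.prod_fiberwise (fun x => ((hsec x).hasSum.mul_left (u ^ (∑ j, (j.1 + 1) * x j))))
  have hf := (fiber_hasSum (fun x : Fin k → ℕ => ∑ j, (j.1 + 1) * x j) _ _).2 hx
  have hn := (hf.prod_fiberwise (fun n => (hf.summable.prod_factor n).hasSum)).mul_left
    (Real.exp (t * θ ^ α))
  have hfin : HasSum (fun n : ℕ => u ^ n * tgcpPMF α θ k lam t n)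
      (Real.exp (-(t * (((∑ j, lam j * (1 - u ^ (j.1 + 1))) + θ) ^ α - θ ^ α)))) := by
    convert! hn using 1
    · funext n
      rw [tgcpPMF, mul_left_comm, ← tsum_mul_left]
      congr 1
      refine tsum_congr fun x => ?_
      dsimp only
      split_ifs with hc
      · rw [hc]
      · simp
    · rw [← Real.exp_add]
      congr 1
      have e : (∑ j, lam j * (1 - u ^ (j.1 + 1))) + θ =
          L * (1 - ∑ j, lam j / L * u ^ (j.1 + 1)) := by
        simp only [mul_sub, mul_one, Finset.sum_sub_distrib, Finset.mul_sum]
        have : ∀ j : Fin k, L * (lam j / L * u ^ (j.1 + 1)) = lam j * u ^ (j.1 + 1) := fun j => by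
          field_simp
        simp only [this]
        rw [hL]; ring
      have hnn : 0 ≤ 1 - ∑ j, lam j / L * u ^ (j.1 + 1) := by
        have : 0 ≤ (∑ j, lam j * (1 - u ^ (j.1 + 1))) + θ :=
          add_nonneg (Finset.sum_nonneg fun j _ => mul_nonneg (hlam j).le
            (sub_nonneg.2 (pow_le_one₀ hu0 hu1))) hθ.le
        rw [e] at this
        exact nonneg_of_mul_nonneg_right this hLpos
      rw [e, Real.mul_rpow hLpos.le hnn, hT]; ring
  exact ⟨hfin.summable, hfin.tsum_eq.symm⟩
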